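/- Let φ : [1,∞) → (0,∞) be a C¹, increasing, concave (sublinear) function. Suppose there exist a C² function W : ℝⁿ → ℝ with W ≥ 1 and constants b > 0, R > 0 such that LW(x) ≤ −φ(W(x)) + b·1_{|x| ≤ R}(x) for all x, and suppose μ satisfies the local Poincaré inequality on B(0,R) with constant κ_R. Then the following converse weighted Poincaré inequality holds: for every smooth compactly supported function f, inf_{c ∈ ℝ} ∫ (f − c)² (φ(W)/W) dμ ≤ (1 + b κ_R) ∫ |∇f|² dμ. -/

import Mathlib

open MeasureTheory Real Set
open scoped ENNReal RealInnerProductSpace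

noncomputable section

abbrev En (n : ℕ) := EuclideanSpace ℝ (Fin n)

/-- The Laplacian on `ℝⁿ`: sum of second partial derivatives. -/
def lapl {n : ℕ} (g : En n → ℝ) (x : En n) : ℝ :=
  ∑ i : Fin n,
    fderiv ℝ (fun y => fderiv ℝ g y (EuclideanSpace.single i 1)) x (EuclideanSpace.single i 1)

/-- The diffusion operator `L g = Δ g - ∇V · ∇g`. -/
def Lop {n : ℕ} (V g : En n → ℝ) (x : En n) : ℝ :=
  lapl g x - ⟪gradient V x, gradient g x⟫

/-- The Boltzmann measure `dμ = e^{-V}/Z dx`. -/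
def boltz {n : ℕ} (V : En n → ℝ) : Measure (En n) :=
  (volume : Measure (En n)).withDensity
    (fun x => ENNReal.ofReal (Real.exp (-V x) / ∫ y, Real.exp (-V y)))

theorem boltz_isFiniteMeasure {n : ℕ} (V : En n → ℝ)
    (hVint : Integrable (fun x => Real.exp (-V x))) : IsFiniteMeasure (boltz V) :=
  isFiniteMeasure_withDensity_ofReal (hVint.div_const _).2

theorem integral_boltz {n : ℕ} {V : En n → ℝ} (hV : Continuous V) (g : En n → ℝ) :
    ∫ x, g x ∂(boltz V) = ∫ x, Real.exp (-V x) / (∫ y, Real.exp (-V y)) * g x := by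
  have hm : Measurable fun x => ENNReal.ofReal (Real.exp (-V x) / ∫ y, Real.exp (-V y)) := by
    fun_prop
  rw [boltz, integral_withDensity_eq_integral_toReal_smul hm (by simp)]
  refine integral_congr_ae (.of_forall fun x => ?_)
  have : 0 ≤ Real.exp (-V x) / ∫ y, Real.exp (-V y) :=
    div_nonneg (Real.exp_pos _).le (integral_nonneg fun y => (Real.exp_pos _).le)
  simp [ENNReal.toReal_ofReal this]

theorem inner_gradient_eq_sum {n : ℕ} (g h : En n → ℝ) (x : En n) :
    ⟪gradient g x, gradient h x⟫ = ∑ i : Fin n,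
      fderiv ℝ g x (EuclideanSpace.single i 1) * fderiv ℝ h x (EuclideanSpace.single i 1) := by
  rw [← (EuclideanSpace.basisFun (Fin n) ℝ).sum_inner_mul_inner]
  refine Finset.sum_congr rfl fun i _ => ?_
  rw [inner_gradient_left, inner_gradient_right]
  simp

theorem continuous_gradient {n : ℕ} {g : En n → ℝ} (hg : ContDiff ℝ 1 g) :
    Continuous (gradient g) :=
  (InnerProductSpace.toDual ℝ (En n)).symm.continuous.comp (hg.continuous_fderiv one_ne_zero)

theorem norm_gradient {n : ℕ} (g : En n → ℝ) (x : En n) :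
    ‖gradient g x‖ = ‖fderiv ℝ g x‖ :=
  (InnerProductSpace.toDual ℝ (En n)).symm.norm_map _

theorem hasCompactSupport_gradient {n : ℕ} {g : En n → ℝ} (hg : HasCompactSupport g) :
    HasCompactSupport (gradient g) :=
  (hg.fderiv ℝ).comp_left (map_zero (InnerProductSpace.toDual ℝ (En n)).symm)

theorem contDiff_fderiv_apply {n : ℕ} {g : En n → ℝ} (hg : ContDiff ℝ 2 g) (v : En n) :
    ContDiff ℝ 1 fun x => fderiv ℝ g x v :=
  (hg.fderiv_right (m := 1) (by norm_num)).clm_apply contDiff_const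

theorem continuous_lapl {n : ℕ} {g : En n → ℝ} (hg : ContDiff ℝ 2 g) : Continuous (lapl g) :=
  continuous_finsetSum _ fun _ _ =>
    ((contDiff_fderiv_apply hg _).continuous_fderiv one_ne_zero).clm_apply continuous_const

/-- Green's formula for a compactly supported test function. -/
theorem integral_mul_lapl_add_inner_eq_zero {n : ℕ} {F W : En n → ℝ} (hF : ContDiff ℝ 1 F)
    (hFc : HasCompactSupport F) (hW : ContDiff ℝ 2 W) :
    ∫ x, (F x * lapl W x + ⟪gradient F x, gradient W x⟫) = 0 := by
  have hd (i : Fin n) := contDiff_fderiv_apply hW (EuclideanSpace.single i 1)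
  have hF' (i : Fin n) : Continuous fun x => fderiv ℝ F x (EuclideanSpace.single i 1) :=
    (hF.continuous_fderiv one_ne_zero).clm_apply continuous_const
  have hFc' (i : Fin n) : HasCompactSupport fun x => fderiv ℝ F x (EuclideanSpace.single i 1) :=
    hFc.fderiv_apply ℝ _
  have h1 (i : Fin n) : Integrable fun x => F x *
      fderiv ℝ (fun y => fderiv ℝ W y (EuclideanSpace.single i 1)) x
        (EuclideanSpace.single i 1) :=
    (hF.continuous.mul (((hd i).continuous_fderiv one_ne_zero).clm_apply
      continuous_const)).integrable_of_hasCompactSupport hFc.mul_right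
  have h2 (i : Fin n) : Integrable fun x => fderiv ℝ F x (EuclideanSpace.single i 1) *
      fderiv ℝ W x (EuclideanSpace.single i 1) :=
    ((hF' i).mul (hd i).continuous).integrable_of_hasCompactSupport (hFc' i).mul_right
  have h3 (i : Fin n) : Integrable fun x => F x * fderiv ℝ W x (EuclideanSpace.single i 1) :=
    (hF.continuous.mul (hd i).continuous).integrable_of_hasCompactSupport hFc.mul_right
  simp_rw [inner_gradient_eq_sum, lapl, Finset.mul_sum, ← Finset.sum_add_distrib]
  rw [integral_finsetSum _ fun i _ => (h1 i).fun_add (h2 i)]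
  refine Finset.sum_eq_zero fun i _ => ?_
  rw [integral_add (h1 i) (h2 i), integral_mul_fderiv_eq_neg_fderiv_mul_of_integrable (h2 i) (h1 i)
    (h3 i) (fun x _ => hF.differentiable one_ne_zero x)
    (fun x _ => (hd i).differentiable one_ne_zero x)]
  simp

/-- Integration by parts for the diffusion operator `L` against its reversible measure. -/
theorem integral_mul_Lop_add_inner_eq_zero {n : ℕ} {V u W : En n → ℝ} (hV : ContDiff ℝ 2 V)
    (hu : ContDiff ℝ 1 u) (huc : HasCompactSupport u) (hW : ContDiff ℝ 2 W) :
    ∫ x, (u x * Lop V W x + ⟪gradient u x, gradient W x⟫) ∂(boltz V) = 0 := by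
  rw [integral_boltz hV.continuous]
  set Z := ∫ y, Real.exp (-V y)
  have hV1 : ContDiff ℝ 1 V := hV.of_le (by norm_num)
  have hρ : ContDiff ℝ 1 fun x => Real.exp (-V x) / Z := hV1.neg.exp.div_const _
  rw [← integral_mul_lapl_add_inner_eq_zero (F := fun x => Real.exp (-V x) / Z * u x) (hρ.mul hu)
    huc.mul_left hW]
  refine integral_congr_ae (.of_forall fun x => ?_)
  have hVx := (hV1.differentiable one_ne_zero x).hasFDerivAt
  have hux := (hu.differentiable one_ne_zero x).hasFDerivAt
  have hF := ((hVx.neg.exp.mul_const Z⁻¹).mul hux).fderiv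
  have hF' : fderiv ℝ (fun x => Real.exp (-V x) / Z * u x) x = _ := hF
  simp only [Lop, inner_gradient_left, hF']
  simp
  ring

/-- The Lyapunov condition bounds the weighted `L²` norm of a compactly supported function. -/
theorem integral_sq_mul_le_of_lyapunov {n : ℕ} {V : En n → ℝ} (hV : ContDiff ℝ 2 V)
    (hVint : Integrable (fun x => Real.exp (-V x)))
    {φ : ℝ → ℝ} (hφ : ContinuousOn φ (Ici 1))
    {W : En n → ℝ} (hW : ContDiff ℝ 2 W) (hW1 : ∀ x, 1 ≤ W x)
    {b R : ℝ} (hb : 0 < b)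
    (hLyap : ∀ x, Lop V W x ≤ -φ (W x) + (if ‖x‖ ≤ R then b else 0))
    {h : En n → ℝ} (hh : ContDiff ℝ 1 h) (hhc : HasCompactSupport h) :
    ∫ x, h x ^ 2 * (φ (W x) / W x) ∂(boltz V) ≤
      ∫ x, ‖gradient h x‖ ^ 2 ∂(boltz V) +
        b * ∫ x in {x : En n | ‖x‖ ≤ R}, h x ^ 2 ∂(boltz V) := by
  have := boltz_isFiniteMeasure V hVint
  have hB : MeasurableSet {x : En n | ‖x‖ ≤ R} := measurableSet_le measurable_norm measurable_const
  have hWpos (x) : 0 < W x := one_pos.trans_le (hW1 x)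
  have hW1' : ContDiff ℝ 1 W := hW.of_le (by norm_num)
  have hV1 : ContDiff ℝ 1 V := hV.of_le (by norm_num)
  have hh2c : HasCompactSupport fun x => h x ^ 2 := hhc.comp_left (g := fun t : ℝ => t ^ 2) (by simp)
  set u : En n → ℝ := fun x => h x ^ 2 * (W x)⁻¹ with hu_def
  have hu : ContDiff ℝ 1 u := (hh.pow 2).mul (hW1'.inv fun x => (hWpos x).ne')
  have huc : HasCompactSupport u := hh2c.mul_right
  have i1 : Integrable (fun x => h x ^ 2 * (φ (W x) / W x)) (boltz V) := by
    refine Continuous.integrable_of_hasCompactSupport ?_ hh2c.mul_right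
    exact (hh.continuous.pow 2).mul
      ((hφ.comp_continuous hW.continuous hW1).div hW.continuous fun x => (hWpos x).ne')
  have i2 : Integrable (fun x => ‖gradient h x‖ ^ 2) (boltz V) := by
    refine Continuous.integrable_of_hasCompactSupport ((continuous_gradient hh).norm.pow 2) ?_
    exact (hasCompactSupport_gradient hhc).comp_left (g := fun v : En n => ‖v‖ ^ 2) (by simp)
  have i3 : Integrable (fun x => h x ^ 2) (boltz V) :=
    (hh.continuous.pow 2).integrable_of_hasCompactSupport hh2c
  have i4 : Integrable ({x : En n | ‖x‖ ≤ R}.indicator fun x => h x ^ 2) (boltz V) :=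
    i3.indicator hB
  have i5 : Integrable (fun x => u x * Lop V W x + ⟪gradient u x, gradient W x⟫) (boltz V) := by
    refine Integrable.add ?_ ?_
    · refine Continuous.integrable_of_hasCompactSupport ?_ huc.mul_right
      exact hu.continuous.mul ((continuous_lapl hW).sub
        ((continuous_gradient hV1).inner (continuous_gradient hW1')))
    · refine Continuous.integrable_of_hasCompactSupport
        ((continuous_gradient hu).inner (continuous_gradient hW1')) ?_
      refine (hasCompactSupport_gradient huc).mono fun x hx h0 => hx ?_
      simp [h0]
  have key : ∀ x, u x * Lop V W x + ⟪gradient u x, gradient W x⟫ ≤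
      ‖gradient h x‖ ^ 2 + b * {x : En n | ‖x‖ ≤ R}.indicator (fun x => h x ^ 2) x
        - h x ^ 2 * (φ (W x) / W x) := by
    intro x
    have hhx := (hh.differentiable one_ne_zero x).hasFDerivAt
    have hWx := (hW1'.differentiable one_ne_zero x).hasFDerivAt
    have hinv : HasFDerivAt (fun x => (W x)⁻¹) (-(W x ^ 2)⁻¹ • fderiv ℝ W x) x :=
      (hasDerivAt_inv (hWpos x).ne').comp_hasFDerivAt x hWx
    have hux : fderiv ℝ u x = _ := ((hhx.pow 2).mul hinv).fderiv
    have hgrad : ⟪gradient u x, gradient W x⟫ =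
        2 * ⟪gradient h x, (h x / W x) • gradient W x⟫ - ‖(h x / W x) • gradient W x‖ ^ 2 := by
      rw [← real_inner_self_eq_norm_sq, inner_smul_right, inner_smul_left, inner_smul_right,
        inner_gradient_left, inner_gradient_left, inner_gradient_left, hux]
      have := (hWpos x).ne'
      simp
      field_simp
      ring
    have hle : ⟪gradient u x, gradient W x⟫ ≤ ‖gradient h x‖ ^ 2 := by
      rw [hgrad]
      nlinarith [norm_sub_sq_real (gradient h x) ((h x / W x) • gradient W x),
        sq_nonneg ‖gradient h x - (h x / W x) • gradient W x‖]
    have hu0 : 0 ≤ u x := mul_nonneg (sq_nonneg _) (inv_nonneg.2 (hWpos x).le)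
    have hu1 : u x ≤ h x ^ 2 :=
      mul_le_of_le_one_right (sq_nonneg _) (inv_le_one_of_one_le₀ (hW1 x))
    have hL := mul_le_mul_of_nonneg_left (hLyap x) hu0
    have e1 : u x * φ (W x) = h x ^ 2 * (φ (W x) / W x) := by
      simp only [hu_def]; ring
    by_cases hx : ‖x‖ ≤ R
    · rw [indicator_of_mem (by exact hx)]
      rw [if_pos hx] at hL
      nlinarith
    · rw [indicator_of_notMem (by exact hx)]
      rw [if_neg hx] at hL
      nlinarith
  have hint := integral_mono i5 (Integrable.sub (i2.fun_add (i4.const_mul b)) i1) key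
  rw [integral_mul_Lop_add_inner_eq_zero hV hu huc hW] at hint
  rw [integral_sub' (i2.fun_add (i4.const_mul b)) i1, integral_add i2 (i4.const_mul b),
    integral_const_mul, integral_indicator hB] at hint
  linarith

/-- Smooth cutoffs equal to `1` on balls exhausting the space, with gradients tending to `0`. -/
theorem exists_cutoff_seq (n : ℕ) : ∃ (M : ℝ) (χ : ℕ → En n → ℝ),
    (∀ k, ContDiff ℝ 1 (χ k)) ∧ (∀ k, HasCompactSupport (χ k)) ∧
    (∀ k x, 0 ≤ χ k x ∧ χ k x ≤ 1) ∧ (∀ k x, ‖fderiv ℝ (χ k) x‖ ≤ M) ∧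
    ∀ x, ∀ᶠ k in Filter.atTop, χ k =ᶠ[nhds x] 1 := by
  let B : ContDiffBump (0 : En n) := ⟨1, 2, one_pos, one_lt_two⟩
  have hB : ContDiff ℝ 1 B := B.contDiff
  obtain ⟨M, hM⟩ := (hB.continuous_fderiv one_ne_zero).bounded_above_of_compact_support
    (B.hasCompactSupport.fderiv ℝ)
  have hpos (k : ℕ) : (0 : ℝ) < ((k : ℝ) + 1)⁻¹ := by positivity
  refine ⟨M, fun k x => B (((k : ℝ) + 1)⁻¹ • x), fun k => hB.comp (contDiff_const_smul _),
    fun k => ?_, fun k x => ⟨B.nonneg, B.le_one⟩, fun k x => ?_, fun x => ?_⟩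
  · exact B.hasCompactSupport.comp_homeomorph (Homeomorph.smulOfNeZero _ (hpos k).ne')
  · have hk : ((k : ℝ) + 1)⁻¹ ≤ 1 := inv_le_one_of_one_le₀ (by linarith [k.cast_nonneg (α := ℝ)])
    rw [fderiv_comp_smul, norm_smul, Real.norm_of_nonneg (hpos k).le]
    exact (mul_le_of_le_one_left (norm_nonneg _) hk).trans (hM _)
  · filter_upwards [Filter.eventually_ge_atTop ⌈‖x‖⌉₊] with k hk
    have hxk : ‖x‖ < (k : ℝ) + 1 := (Nat.ceil_le.1 hk).trans_lt (lt_add_one _)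
    filter_upwards [continuous_norm.continuousAt.eventually_lt_const hxk] with y hy
    refine B.one_of_mem_closedBall ?_
    rw [mem_closedBall_zero_iff, norm_smul, Real.norm_of_nonneg (hpos k).le]
    exact (inv_mul_le_one₀ (by positivity)).2 hy.le

/-- The bound of `integral_sq_mul_le_of_lyapunov` for shifts of compactly supported functions. -/
theorem integral_sub_sq_mul_le_of_lyapunov {n : ℕ} {V : En n → ℝ} (hV : ContDiff ℝ 2 V)
    (hVint : Integrable (fun x => Real.exp (-V x)))
    {φ : ℝ → ℝ} (hφpos : ∀ t ∈ Ici (1 : ℝ), 0 < φ t) (hφ : ContinuousOn φ (Ici 1))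
    {W : En n → ℝ} (hW : ContDiff ℝ 2 W) (hW1 : ∀ x, 1 ≤ W x)
    {b R : ℝ} (hb : 0 < b)
    (hLyap : ∀ x, Lop V W x ≤ -φ (W x) + (if ‖x‖ ≤ R then b else 0))
    {f : En n → ℝ} (hf : ContDiff ℝ 1 f) (hfc : HasCompactSupport f) (c : ℝ) :
    ∫ x, (f x - c) ^ 2 * (φ (W x) / W x) ∂(boltz V) ≤
      ∫ x, ‖gradient f x‖ ^ 2 ∂(boltz V) +
        b * ∫ x in {x : En n | ‖x‖ ≤ R}, (f x - c) ^ 2 ∂(boltz V) := by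
  have := boltz_isFiniteMeasure V hVint
  have hw (x) : 0 ≤ φ (W x) / W x :=
    div_nonneg (hφpos _ (hW1 x)).le (zero_le_one.trans (hW1 x))
  have hwc : Continuous fun x => φ (W x) / W x :=
    (hφ.comp_continuous hW.continuous hW1).div hW.continuous
      fun x => (one_pos.trans_le (hW1 x)).ne'
  by_cases hint : Integrable (fun x => (f x - c) ^ 2 * (φ (W x) / W x)) (boltz V)
  swap
  · rw [integral_undef hint]
    have h1 : 0 ≤ ∫ x, ‖gradient f x‖ ^ 2 ∂(boltz V) := integral_nonneg fun x => by positivity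
    have h2 : 0 ≤ ∫ x in {x : En n | ‖x‖ ≤ R}, (f x - c) ^ 2 ∂(boltz V) :=
      integral_nonneg fun x => sq_nonneg _
    positivity
  obtain ⟨M, χ, hχ, hχc, hχ01, hχM, hχ1⟩ := exists_cutoff_seq n
  obtain ⟨A, hA⟩ := hf.continuous.bounded_above_of_compact_support hfc
  obtain ⟨A', hA'⟩ := (hf.continuous_fderiv one_ne_zero).bounded_above_of_compact_support
    (hfc.fderiv ℝ)
  have hg : ContDiff ℝ 1 fun x => f x - c := hf.sub contDiff_const
  have hgA (x) : ‖f x - c‖ ≤ A + ‖c‖ := (norm_sub_le _ _).trans (by gcongr; exact hA x)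
  set h : ℕ → En n → ℝ := fun k x => χ k x * (f x - c) with hh_def
  have hh (k) : ContDiff ℝ 1 (h k) := (hχ k).mul hg
  have hsq (k x) : h k x ^ 2 ≤ (f x - c) ^ 2 := by
    rw [hh_def, mul_pow]
    exact mul_le_of_le_one_left (sq_nonneg _) (pow_le_one₀ (hχ01 k x).1 (hχ01 k x).2)
  have hlim (x) : ∀ᶠ k in Filter.atTop, h k =ᶠ[nhds x] fun y => f y - c := by
    filter_upwards [hχ1 x] with k hk
    filter_upwards [hk] with y hy
    simp [hh_def, hy]
  have hgrad (k x) : ‖gradient (h k) x‖ ≤ A' + (A + ‖c‖) * M := by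
    have e : fderiv ℝ (h k) x = _ := (((hχ k).differentiable one_ne_zero x).hasFDerivAt.mul
      ((hf.differentiable one_ne_zero x).hasFDerivAt.sub_const c)).fderiv
    rw [norm_gradient, e]
    refine (norm_add_le _ _).trans ?_
    rw [norm_smul, norm_smul, Real.norm_of_nonneg (hχ01 k x).1]
    refine add_le_add ?_ ?_
    · exact (mul_le_of_le_one_left (norm_nonneg _) (hχ01 k x).2).trans (hA' x)
    · exact mul_le_mul (hgA x) (hχM k x) (norm_nonneg _) ((norm_nonneg _).trans (hgA x))
  have t1 : Filter.Tendsto (fun k => ∫ x, h k x ^ 2 * (φ (W x) / W x) ∂(boltz V)) Filter.atTop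
      (nhds (∫ x, (f x - c) ^ 2 * (φ (W x) / W x) ∂(boltz V))) := by
    refine tendsto_integral_of_dominated_convergence _
      (fun k => (((hh k).continuous.pow 2).mul hwc).aestronglyMeasurable) hint
      (fun k => .of_forall fun x => ?_) (.of_forall fun x => ?_)
    · rw [Real.norm_of_nonneg (mul_nonneg (sq_nonneg _) (hw x))]
      exact mul_le_mul_of_nonneg_right (hsq k x) (hw x)
    · refine tendsto_const_nhds.congr' ?_
      filter_upwards [hlim x] with k hk
      rw [hk.eq_of_nhds]
  have t2 : Filter.Tendsto (fun k => ∫ x, ‖gradient (h k) x‖ ^ 2 ∂(boltz V)) Filter.atTop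
      (nhds (∫ x, ‖gradient f x‖ ^ 2 ∂(boltz V))) := by
    refine tendsto_integral_of_dominated_convergence (fun _ => (A' + (A + ‖c‖) * M) ^ 2)
      (fun k => ((continuous_gradient (hh k)).norm.pow 2).aestronglyMeasurable)
      (integrable_const _)
      (fun k => .of_forall fun x => ?_) (.of_forall fun x => ?_)
    · rw [Real.norm_of_nonneg (sq_nonneg _)]
      exact pow_le_pow_left₀ (norm_nonneg _) (hgrad k x) 2
    · refine tendsto_const_nhds.congr' ?_
      filter_upwards [hlim x] with k hk
      rw [norm_gradient, norm_gradient, hk.fderiv_eq, fderiv_sub_const]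
  have t3 : Filter.Tendsto
      (fun k => ∫ x in {x : En n | ‖x‖ ≤ R}, h k x ^ 2 ∂(boltz V)) Filter.atTop
      (nhds (∫ x in {x : En n | ‖x‖ ≤ R}, (f x - c) ^ 2 ∂(boltz V))) := by
    refine tendsto_integral_of_dominated_convergence (fun _ => (A + ‖c‖) ^ 2)
      (fun k => ((hh k).continuous.pow 2).aestronglyMeasurable)
      (integrable_const _)
      (fun k => .of_forall fun x => ?_) (.of_forall fun x => ?_)
    · rw [Real.norm_of_nonneg (sq_nonneg _)]
      refine (hsq k x).trans ?_
      rw [← Real.norm_of_nonneg (sq_nonneg (f x - c)), norm_pow]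
      exact pow_le_pow_left₀ (norm_nonneg _) (hgA x) 2
    · refine tendsto_const_nhds.congr' ?_
      filter_upwards [hlim x] with k hk
      rw [hk.eq_of_nhds]
  exact le_of_tendsto_of_tendsto' t1 (t2.add (t3.const_mul b)) fun k =>
    integral_sq_mul_le_of_lyapunov hV hVint hφ hW hW1 hb hLyap (hh k) (hχc k).mul_right

/-- The integral of the squared deviation from the mean over a set. -/
theorem setIntegral_sub_mean_sq {α : Type*} [MeasurableSpace α] {μ : Measure α}
    [IsFiniteMeasure μ] {s : Set α} {f : α → ℝ} (hf : Integrable f μ)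
    (hf2 : Integrable (fun x => f x ^ 2) μ) :
    ∫ x in s, (f x - (μ s).toReal⁻¹ * ∫ y in s, f y ∂μ) ^ 2 ∂μ =
      ∫ x in s, f x ^ 2 ∂μ - (μ s).toReal⁻¹ * (∫ x in s, f x ∂μ) ^ 2 := by
  set c := (μ s).toReal⁻¹ * ∫ y in s, f y ∂μ with hc
  have e : ∀ x, (f x - c) ^ 2 = f x ^ 2 - 2 * c * f x + c ^ 2 := fun x => by ring
  simp_rw [e]
  have j1 : Integrable (fun x => f x ^ 2) (μ.restrict s) := hf2.restrict
  have j2 : Integrable (fun x => 2 * c * f x) (μ.restrict s) := hf.restrict.const_mul _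
  have j3 : Integrable (fun x => f x ^ 2 - 2 * c * f x) (μ.restrict s) := j1.sub j2
  rw [integral_add j3 (integrable_const _), integral_sub j1 j2, integral_const_mul]
  simp only [integral_const, smul_eq_mul, Measure.real, Measure.restrict_apply_univ]
  by_cases h0 : (μ s).toReal = 0
  · simp [hc, h0]
  · rw [hc]
    field_simp
    ring

/-- a sublinear `φ`-Lyapunov condition plus a local Poincaré inequality implies
the converse weighted Poincaré inequality
`inf_c ∫ (f-c)² φ(W)/W dμ ≤ (1 + bκ_R) ∫ |∇f|² dμ`. -/
theorem stmt7 {n : ℕ} (hn : 0 < n) (V : En n → ℝ) (hV : ContDiff ℝ 2 V)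
    (hVint : Integrable (fun x => Real.exp (-V x)))
    (φ : ℝ → ℝ)
    (hφpos : ∀ t ∈ Ici (1 : ℝ), 0 < φ t)
    (hφC1 : ContDiffOn ℝ 1 φ (Ici 1))
    (hφmono : StrictMonoOn φ (Ici 1))
    (hφconc : ConcaveOn ℝ (Ici 1) φ)
    (W : En n → ℝ) (hW : ContDiff ℝ 2 W) (hW1 : ∀ x, 1 ≤ W x)
    (b R : ℝ) (hb : 0 < b) (hR : 0 < R)
    (hLyap : ∀ x, Lop V W x ≤ -φ (W x) + (if ‖x‖ ≤ R then b else 0))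
    (κ : ℝ)
    (hloc : ∀ f : En n → ℝ, ContDiff ℝ (⊤ : ℕ∞) f → HasCompactSupport f →
      ∫ x in {x : En n | ‖x‖ ≤ R}, (f x) ^ 2 ∂(boltz V)
        ≤ κ * ∫ x, ‖gradient f x‖ ^ 2 ∂(boltz V)
          + ((boltz V) {x : En n | ‖x‖ ≤ R}).toReal⁻¹
              * (∫ x in {x : En n | ‖x‖ ≤ R}, f x ∂(boltz V)) ^ 2)
    (f : En n → ℝ) (hf : ContDiff ℝ (⊤ : ℕ∞) f) (hfc : HasCompactSupport f) :
    ⨅ c : ℝ, ∫ x, (f x - c) ^ 2 * (φ (W x) / W x) ∂(boltz V)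
      ≤ (1 + b * κ) * ∫ x, ‖gradient f x‖ ^ 2 ∂(boltz V) := by
  have := boltz_isFiniteMeasure V hVint
  have hf1 : ContDiff ℝ 1 f := contDiff_infty.1 hf 1
  have hfi : Integrable f (boltz V) := hf.continuous.integrable_of_hasCompactSupport hfc
  have hf2c : HasCompactSupport fun x => f x ^ 2 :=
    hfc.comp_left (g := fun t : ℝ => t ^ 2) (zero_pow two_ne_zero)
  have hf2 : Integrable (fun x => f x ^ 2) (boltz V) :=
    (hf.continuous.pow 2).integrable_of_hasCompactSupport hf2c
  have hbdd : BddBelow (range fun c : ℝ =>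
      ∫ x, (f x - c) ^ 2 * (φ (W x) / W x) ∂(boltz V)) := by
    refine ⟨0, ?_⟩
    rintro _ ⟨c, rfl⟩
    exact integral_nonneg fun x => mul_nonneg (sq_nonneg _)
      (div_nonneg (hφpos _ (hW1 x)).le (zero_le_one.trans (hW1 x)))
  refine (ciInf_le hbdd (((boltz V) {x : En n | ‖x‖ ≤ R}).toReal⁻¹ *
    ∫ x in {x : En n | ‖x‖ ≤ R}, f x ∂(boltz V))).trans ?_
  refine (integral_sub_sq_mul_le_of_lyapunov hV hVint hφpos hφC1.continuousOn hW hW1 hb hLyap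
    hf1 hfc _).trans ?_
  rw [setIntegral_sub_mean_sq hfi hf2]
  calc _ ≤ ∫ x, ‖gradient f x‖ ^ 2 ∂(boltz V) +
        b * (κ * ∫ x, ‖gradient f x‖ ^ 2 ∂(boltz V)) := by
        gcongr
        exact sub_le_iff_le_add.2 (hloc f hf hfc)
    _ = _ := by ring
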